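/- Let K be an algebraically closed field, let n ∈ Y, and suppose that for every m < n the subspaces U(2^m), V(2^m) (together with subspaces F(2^m)) satisfy conditions (1)–(8) at every index m < n. Then there exist K-subspaces F'(2^n), F(2^n) ⊆ A(2^n) such that: (i) 0 < dim_K F'(2^n) ≤ (1/2)·(dim_K V(2^{n−1}))^2 and for every f among f_1, …, f_ξ with k := deg f satisfying 2^n + 2^{n−1} ≤ k ≤ 2^n + 2^{n−1} + 2^{n−2} and all i, j ≥ 0 with i + j = k − 2^n, one has f ∈ A(i)F'(2^n)A(j) + U^<(i)A(k−i) + A(k−j)U^>(j); (ii) dim_K F(2^n) ≤ (dim_K V(2^{n−1}))^2 − 2; (iii) F'(2^n) ⊆ F(2^n) + U(2^{n−1})A(2^{n−1}) + A(2^{n−1})U(2^{n−1}); and (iv) for every f among f_1, …, f_ξ with 2^n + 2^{n−1} ≤ deg f ≤ 2^n + 2^{n−1} + 2^{n−2}, AfA ∩ A(2^{n+1}) ⊆ A(2^n)F(2^n) + F(2^n)A(2^n) + A(2^{n−1})U(2^{n−1})A(2^n) + A(2^n)U(2^{n−1})A(2^{n−1}) + U(2^{n−1})A(2^n + 2^{n−1})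 + A(2^n + 2^{n−1})U(2^{n−1}). -/

import Mathlib

/-
Formalization of statements from:
"Golod-Shafarevich algebras of a reduced number of defining relations" (A. Smoktunowicz).

`FA K` is the free associative unital `K`-algebra `A = K⟨x,y⟩` on two generators
(`FreeAlgebra.ι K 0` and `FreeAlgebra.ι K 1`), graded with the generators in degree 1.
-/

open scoped Pointwise Classical

noncomputable section

/-- The free associative unital `K`-algebra on two generators. -/
abbrev FA (K : Type) [Field K] : Type := FreeAlgebra K (Fin 2)

variable (K : Type) [Field K]

/-- The set of monomials of degree `k` in the free algebra on two generators. -/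
def Mon (k : ℕ) : Set (FA K) :=
  { m | ∃ w : List (Fin 2), w.length = k ∧ m = (w.map (FreeAlgebra.ι K)).prod }

/-- `Adeg K k` is the `k`-th homogeneous component `A(k)`: the span of the monomials of
degree `k`. -/
def Adeg (k : ℕ) : Submodule K (FA K) :=
  Submodule.span K (Mon K k)

/-- Properties (1)-(4) of the families `U(2^m)`, `V(2^m)` of subspaces of `A(2^m)`
(Section 1 of the paper):
(1) `V(2^m)` is spanned by monomials (of degree `2^m`);
(2) `V(2^m) + U(2^m) = A(2^m)` and `V(2^m) ∩ U(2^m) = 0`;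
(3) `A(2^{m-1})U(2^{m-1}) + U(2^{m-1})A(2^{m-1}) ⊆ U(2^m)`;
(4) `V(2^m) ⊆ V(2^{m-1})V(2^{m-1})`;
with `V(2^0) = Kx + Ky` and `U(2^0) = 0`. -/
def UVCond (U V : ℕ → Submodule K (FA K)) : Prop :=
  V 0 = Submodule.span K {FreeAlgebra.ι K 0, FreeAlgebra.ι K 1} ∧
  U 0 = ⊥ ∧
  ∀ m : ℕ, 1 ≤ m →
    (∃ s ⊆ Mon K (2 ^ m), V m = Submodule.span K s) ∧
    U m ≤ Adeg K (2 ^ m) ∧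
    V m ⊔ U m = Adeg K (2 ^ m) ∧
    V m ⊓ U m = ⊥ ∧
    Adeg K (2 ^ (m - 1)) * U (m - 1) ⊔ U (m - 1) * Adeg K (2 ^ (m - 1)) ≤ U m ∧
    V m ≤ V (m - 1) * V (m - 1)

/-- The homogeneous component `E(k)` (as a set), for `k ≥ 1`.  For the unique `n` with
`2^(n-1) ≤ k < 2^n` (i.e. `n = Nat.log 2 k + 1`) it consists of those `r ∈ A(k)` with
`A r A ∩ A(2^(n+1)) ⊆ U(2^n)A(2^n) + A(2^n)U(2^n)`; here `A r A` is the two-sided ideal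
generated by `r`, realized as the subspace `⊤ * span{r} * ⊤`. -/
def ESet (U : ℕ → Submodule K (FA K)) (k : ℕ) : Set (FA K) :=
  { r | r ∈ Adeg K k ∧
    (⊤ : Submodule K (FA K)) * Submodule.span K {r} * ⊤ ⊓ Adeg K (2 ^ (Nat.log 2 k + 2)) ≤
      U (Nat.log 2 k + 1) * Adeg K (2 ^ (Nat.log 2 k + 1)) ⊔
        Adeg K (2 ^ (Nat.log 2 k + 1)) * U (Nat.log 2 k + 1) }

/-- The graded subspace `E = ⊕_{k ≥ 1} E(k)` (each `E(k)` is a subspace, so the span of the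
union of the `E(k)` is their direct sum). -/
def Esub (U : ℕ → Submodule K (FA K)) : Submodule K (FA K) :=
  Submodule.span K (⋃ k ∈ Set.Ici 1, ESet K U k)

/-- Auxiliary: the product of the `V(2^p)` over the set bits of `k`, lowest bit first,
with bit positions shifted by `i`. -/
def prodLow (V : ℕ → Submodule K (FA K)) (i k : ℕ) : Submodule K (FA K) :=
  if _h : k = 0 then 1
  else (if k % 2 = 1 then V i else 1) * prodLow V (i + 1) (k / 2)
termination_by k
decreasing_by exact Nat.div_lt_self (Nat.pos_of_ne_zero _h) one_lt_two

/-- Auxiliary: the product of the `V(2^p)` over the set bits of `k`, highest bit first. -/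
def prodHigh (V : ℕ → Submodule K (FA K)) (i k : ℕ) : Submodule K (FA K) :=
  if _h : k = 0 then 1
  else prodHigh V (i + 1) (k / 2) * (if k % 2 = 1 then V i else 1)
termination_by k
decreasing_by exact Nat.div_lt_self (Nat.pos_of_ne_zero _h) one_lt_two

/-- `V^<(k) = V(2^{p_1}) ⋯ V(2^{p_t})` where `k = 2^{p_1} + ⋯ + 2^{p_t}` in binary with
`p_1 < ⋯ < p_t`; `V^<(0) = K·1`. -/
def Vlt (V : ℕ → Submodule K (FA K)) (k : ℕ) : Submodule K (FA K) := prodLow K V 0 k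

/-- `V^>(k) = V(2^{p_t}) ⋯ V(2^{p_1})`; `V^>(0) = K·1`. -/
def Vgt (V : ℕ → Submodule K (FA K)) (k : ℕ) : Submodule K (FA K) := prodHigh K V 0 k

/-- `U^<(k) = Σ_i A(2^{p_1}+⋯+2^{p_{i-1}}) U(2^{p_i}) A(2^{p_{i+1}}+⋯+2^{p_t})`
(for each set bit `p_i` of `k`, the lower part of `k` is `k % 2^{p_i}` and the upper part
is `k - k % 2^{p_i} - 2^{p_i}`); `U^<(0) = 0`. -/
def Ult (U : ℕ → Submodule K (FA K)) (k : ℕ) : Submodule K (FA K) :=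
  ⨆ (p : ℕ) (_ : k.testBit p),
    Adeg K (k % 2 ^ p) * U p * Adeg K (k - k % 2 ^ p - 2 ^ p)

/-- `U^>(k) = Σ_i A(2^{p_t}+⋯+2^{p_{i+1}}) U(2^{p_i}) A(2^{p_{i-1}}+⋯+2^{p_1})`;
`U^>(0) = 0`. -/
def Ugt (U : ℕ → Submodule K (FA K)) (k : ℕ) : Submodule K (FA K) :=
  ⨆ (p : ℕ) (_ : k.testBit p),
    Adeg K (k - k % 2 ^ p - 2 ^ p) * U p * Adeg K (k % 2 ^ p)

/-- The Capelli polynomial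
`d_n(x_1,…,x_n; y_1,…,y_n) = Σ_{σ ∈ Sym(n)} sgn(σ) x_{σ(1)} y_1 x_{σ(2)} y_2 ⋯ x_{σ(n)} y_n`,
evaluated in a ring. -/
def capelli {R : Type*} [Ring R] (n : ℕ) (x y : Fin n → R) : R :=
  ∑ σ : Equiv.Perm (Fin n),
    (Equiv.Perm.sign σ : ℤ) • ((List.finRange n).map fun i => x (σ i) * y i).prod

/-- The quotient map `R → R ⧸ c` (for a ring congruence `c`) as a `K`-linear map. -/
def mkLin {R : Type*} [Semiring R] [Algebra K R] (c : RingCon R) :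
    R →ₗ[K] c.Quotient where
  toFun := RingCon.toQuotient
  map_add' _ _ := rfl
  map_smul' _ _ := rfl

/-- A two-sided ideal of the free algebra is homogeneous iff it is spanned by its
homogeneous elements. -/
def IsHomogTSI (J : TwoSidedIdeal (FA K)) : Prop :=
  (J : Set (FA K)) ⊆ ↑(Submodule.span K {a : FA K | a ∈ J ∧ ∃ n, a ∈ Adeg K n})

/-- `S = ⋃_{n ∈ Y} {n - e(n) - 1, …, n - 1}`. -/
def SetS (Y : Set ℕ) (e : ℕ → ℕ) : Set ℕ :=
  ⋃ n ∈ Y, Set.Icc (n - e n - 1) (n - 1)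

/-- Conditions (1)-(8) of Theorem 4.1 of the paper, at index `m`, for the families
`F(2^m)`, `U(2^m)`, `V(2^m)` of subspaces of `A(2^m)`:
(1) `dim V(2^m) = 2` if `m ∉ S` and (in case `Y` is finite) `m ≤ max Y`;
(2) `dim V(2^{k-e(k)-1+j}) = 2^{2^j}` for all `k ∈ Y` and `0 ≤ j ≤ e(k)`;
(3) `V(2^m)` is spanned by monomials;
(4) `F(2^m) ⊆ U(2^m)` for `m ∈ Y`, and `F(2^m) = 0` for `m ∉ Y`;
(5) `V(2^m) ⊕ U(2^m) = A(2^m)`;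
(6) `A(2^{m-1})U(2^{m-1}) + U(2^{m-1})A(2^{m-1}) ⊆ U(2^m)`;
(7) `V(2^m) ⊆ V(2^{m-1})V(2^{m-1})`;
(8) if `Y` is finite and `m > max Y`, then `dim V(2^m) = 1`. -/
def Conds (Y : Set ℕ) (e : ℕ → ℕ) (F U V : ℕ → Submodule K (FA K)) (m : ℕ) : Prop :=
  (m ∉ SetS Y e → (Y.Finite → ∃ k ∈ Y, m ≤ k) → Module.finrank K (V m) = 2) ∧
  (∀ k ∈ Y, ∀ j ≤ e k, k - e k - 1 + j = m → Module.finrank K (V m) = 2 ^ 2 ^ j) ∧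
  (∃ s ⊆ Mon K (2 ^ m), V m = Submodule.span K s) ∧
  (m ∈ Y → F m ≤ U m) ∧ (m ∉ Y → F m = ⊥) ∧
  U m ≤ Adeg K (2 ^ m) ∧
  V m ⊔ U m = Adeg K (2 ^ m) ∧ V m ⊓ U m = ⊥ ∧
  (Adeg K (2 ^ (m - 1)) * U (m - 1) ⊔ U (m - 1) * Adeg K (2 ^ (m - 1)) ≤ U m) ∧
  V m ≤ V (m - 1) * V (m - 1) ∧
  (Y.Finite → (∀ k ∈ Y, k < m) → Module.finrank K (V m) = 1)

/-- Over an algebraically closed field there is a point which is never the only common zero of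
fewer polynomials than variables. -/
theorem MvPolynomial.exists_point_forall_exists_ne_common_zero {k σ : Type*} [Field k]
    [IsAlgClosed k] [Finite σ] :
    ∃ a : σ → k, ∀ s : Finset (MvPolynomial σ k), s.card < Nat.card σ →
      (∀ p ∈ s, MvPolynomial.eval a p = 0) →
      ∃ b, b ≠ a ∧ ∀ p ∈ s, MvPolynomial.eval b p = 0 := by
  have hdim : ringKrullDim (MvPolynomial σ k) = Nat.card σ := by
    rw [MvPolynomial.ringKrullDim_of_isNoetherianRing, ringKrullDim_eq_zero_of_field, zero_add]
  have : FiniteRingKrullDim (MvPolynomial σ k) := by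
    rw [finiteRingKrullDim_iff_ne_bot_and_top, hdim]
    refine ⟨?_, ?_⟩
    · exact WithBot.coe_ne_bot (a := ((Nat.card σ : ℕ) : ℕ∞))
    · exact fun h => ENat.natCast_ne_top (Nat.card σ) (WithBot.coe_injective h)
  obtain ⟨M, hM, hMh⟩ := Ideal.exists_isMaximal_height (R := MvPolynomial σ k)
  obtain ⟨a, rfl⟩ := MvPolynomial.eq_vanishingIdeal_singleton_of_isMaximal k hM
  refine ⟨a, fun s hs h0 => ?_⟩
  by_contra! hcon
  have hz : MvPolynomial.zeroLocus k (Ideal.span (s : Set (MvPolynomial σ k))) = {a} := by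
    rw [MvPolynomial.zeroLocus_span]
    ext b
    simp only [Set.mem_ofPred_eq, Set.mem_singleton_iff, MvPolynomial.aeval_eq_eval]
    constructor
    · intro hb
      by_contra hne
      obtain ⟨p, hp, hp'⟩ := hcon b hne
      exact hp' (hb p hp)
    · rintro rfl
      exact h0
  have hrad := MvPolynomial.vanishingIdeal_zeroLocus_eq_radical (k := k) (K := k)
    (Ideal.span (s : Set (MvPolynomial σ k)))
  rw [hz] at hrad
  have hmin : MvPolynomial.vanishingIdeal k {a} ∈
      (Ideal.span (s : Set (MvPolynomial σ k))).minimalPrimes := by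
    rw [← Ideal.radical_minimalPrimes, ← hrad, Ideal.minimalPrimes_eq_subsingleton_self]
    rfl
  have hle := Ideal.height_le_card_of_mem_minimalPrimes_span_finset hmin
  rw [hdim] at hMh
  have h2 : (MvPolynomial.vanishingIdeal k {a}).height = ((Nat.card σ : ℕ) : ℕ∞) := by
    exact_mod_cast hMh
  rw [h2] at hle
  have : Nat.card σ ≤ s.card := by exact_mod_cast hle
  omega

/-- Over an algebraically closed field, fewer bilinear forms than the dimension have a common
nonzero isotropic vector. -/
theorem LinearMap.exists_ne_zero_common_isotropic {k E ι : Type*} [Field k] [IsAlgClosed k]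
    [AddCommGroup E] [Module k E] [FiniteDimensional k E] [Fintype ι]
    (B : ι → E →ₗ[k] E →ₗ[k] k) (h : Fintype.card ι < Module.finrank k E) :
    ∃ x, x ≠ 0 ∧ ∀ i, B i x x = 0 := by
  let b := Module.finBasis k E
  obtain ⟨a, ha⟩ := MvPolynomial.exists_point_forall_exists_ne_common_zero (k := k)
    (σ := Fin (Module.finrank k E))
  let q : ι → MvPolynomial (Fin (Module.finrank k E)) k := fun i =>
    ∑ p, ∑ r, MvPolynomial.C (B i (b p) (b r)) *
      ((MvPolynomial.X p - MvPolynomial.C (a p)) * (MvPolynomial.X r - MvPolynomial.C (a r)))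
  have hq : ∀ i c, MvPolynomial.eval c (q i) =
      B i (∑ p, (c p - a p) • b p) (∑ p, (c p - a p) • b p) := by
    intro i c
    simp only [q, map_sum, map_mul, map_sub, MvPolynomial.eval_C, MvPolynomial.eval_X,
      LinearMap.sum_apply, map_smul, LinearMap.smul_apply, smul_eq_mul]
    rw [Finset.sum_comm]
    refine Finset.sum_congr rfl fun p _ => ?_
    rw [Finset.mul_sum]
    exact Finset.sum_congr rfl fun r _ => by ring
  obtain ⟨c, hca, hc⟩ := ha (Finset.univ.image q)
    (by simpa using Finset.card_image_le.trans_lt h) (by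
      simp only [Finset.mem_image, Finset.mem_univ, true_and, forall_exists_index,
        forall_apply_eq_imp_iff]
      intro i
      simp [hq])
  refine ⟨∑ p, (c p - a p) • b p, fun h0 => hca ?_, fun i => ?_⟩
  · have := Fintype.linearIndependent_iff.1 b.linearIndependent _ h0
    ext p
    exact sub_eq_zero.1 (this p)
  · rw [← hq]
    exact hc _ (Finset.mem_image_of_mem _ (Finset.mem_univ i))

/-- Over an algebraically closed field, `t` bilinear forms on a space of dimension more than
`3 * t + 1` have a common totally isotropic plane. -/
theorem LinearMap.exists_linearIndependent_common_isotropic {k E ι : Type*} [Field k]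
    [IsAlgClosed k] [AddCommGroup E] [Module k E] [FiniteDimensional k E] [Fintype ι]
    (B : ι → E →ₗ[k] E →ₗ[k] k) (h : 3 * Fintype.card ι + 1 < Module.finrank k E) :
    ∃ v : Fin 2 → E, LinearIndependent k v ∧ ∀ i a b, B i (v a) (v b) = 0 := by
  obtain ⟨x, hx0, hx⟩ := LinearMap.exists_ne_zero_common_isotropic B (by omega)
  obtain ⟨l, hl⟩ : ∃ l : Module.Dual k E, l x ≠ 0 := by
    by_contra! hcon
    exact hx0 ((Module.forall_dual_apply_eq_zero_iff k x).1 hcon)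
  let g : E →ₗ[k] k × (ι → k) × (ι → k) :=
    l.prod ((LinearMap.pi fun i => B i x).prod (LinearMap.pi fun i => (B i).flip x))
  have hg := g.finrank_range_add_finrank_ker
  have hr : Module.finrank k (LinearMap.range g) ≤ 1 + (Fintype.card ι + Fintype.card ι) := by
    refine (Submodule.finrank_le _).trans ?_
    simp
  obtain ⟨y, hy0, hy⟩ := LinearMap.exists_ne_zero_common_isotropic
    (fun i => (B i).domRestrict₁₂ (LinearMap.ker g) (LinearMap.ker g)) (by omega)
  have hyg : g y = 0 := y.2
  have hly : l y = 0 := congrArg Prod.fst hyg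
  have hxy : ∀ i, B i x y = 0 := congrFun (congrArg (fun z => z.2.1) hyg)
  have hyx : ∀ i, B i y x = 0 := congrFun (congrArg (fun z => z.2.2) hyg)
  refine ⟨![x, y], ?_, fun i a b => ?_⟩
  · rw [LinearIndependent.pair_iff]
    intro s t hst
    have hs : s = 0 := by
      have := congrArg l hst
      simpa [hly, hl] using this
    subst hs
    refine ⟨rfl, ?_⟩
    simpa [hy0] using hst
  · have hyy : B i y y = 0 := hy i
    fin_cases a <;> fin_cases b <;> simp_all

/-- Finitely many linearly independent functionals take arbitrary prescribed values. -/
theorem LinearIndependent.surjective_pi {k W ι : Type*} [Field k] [AddCommGroup W]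
    [Module k W] [Fintype ι] [DecidableEq ι] {φ : ι → Module.Dual k W}
    (h : LinearIndependent k φ) : Function.Surjective (LinearMap.pi φ) := by
  rw [← LinearMap.range_eq_top]
  by_contra hne
  obtain ⟨c, hc0, hc⟩ := Submodule.exists_le_ker_of_lt_top _ (lt_top_iff_ne_top.2 hne)
  refine hc0 ?_
  have hsum : ∑ a, c (Pi.single a 1) • φ a = 0 := by
    ext w
    have hw : c (LinearMap.pi φ w) = 0 := hc ⟨w, rfl⟩
    rw [← LinearMap.sum_single_apply (fun _ => k) (LinearMap.pi φ w), map_sum] at hw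
    simp only [LinearMap.sum_apply, LinearMap.smul_apply, LinearMap.zero_apply]
    rw [← hw]
    refine Finset.sum_congr rfl fun a _ => ?_
    rw [show Pi.single a (LinearMap.pi φ w a) = φ a w • Pi.single a (1 : k) by
      simp [← Pi.single_smul], map_smul, smul_eq_mul, smul_eq_mul, mul_comm]
  have := Fintype.linearIndependent_iff.1 h _ hsum
  ext a
  simpa using this a

/-- A finite-dimensional subspace contained in `range g ⊔ R` lifts along `g`, modulo `R`, without
increasing its dimension. -/
theorem Submodule.exists_finrank_le_map_sup {k X M : Type*} [Field k] [AddCommGroup X]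
    [Module k X] [AddCommGroup M] [Module k M] (g : X →ₗ[k] M) (R T : Submodule k M)
    [FiniteDimensional k T] (h : T ≤ LinearMap.range g ⊔ R) :
    ∃ T' : Submodule k X, Module.finrank k T' ≤ Module.finrank k T ∧ T ≤ T'.map g ⊔ R := by
  let b := Module.finBasis k T
  have hx : ∀ i, ∃ x, ∃ r ∈ R, g x + r = b i := by
    intro i
    obtain ⟨_, ⟨x, rfl⟩, r, hr, hxr⟩ := Submodule.mem_sup.1 (h (b i).2)
    exact ⟨x, r, hr, hxr⟩
  choose x r hr hxr using hx
  refine ⟨Submodule.span k (Set.range x), ?_, ?_⟩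
  · exact (finrank_range_le_card (R := k) x).trans_eq (Fintype.card_fin _)
  · intro t ht
    have hsum : ((∑ i, b.repr ⟨t, ht⟩ i • b i : T) : M) = t :=
      congrArg Subtype.val (b.sum_repr ⟨t, ht⟩)
    rw [← hsum, Submodule.coe_sum]
    refine Submodule.sum_mem _ fun i _ => ?_
    rw [Submodule.coe_smul, ← hxr]
    refine Submodule.smul_mem _ _ (add_mem (Submodule.mem_sup_left ?_)
      (Submodule.mem_sup_right (hr i)))
    exact Submodule.mem_map_of_mem (Submodule.subset_span ⟨i, rfl⟩)

theorem Submodule.finrank_mul_le {k A : Type*} [Field k] [Ring A] [Algebra k A]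
    (M N : Submodule k A) [FiniteDimensional k M] [FiniteDimensional k N] :
    Module.finrank k ↥(M * N) ≤ Module.finrank k M * Module.finrank k N := by
  rw [← Submodule.mulMap_range, ← Module.finrank_tensorProduct]
  exact LinearMap.finrank_range_le _

theorem Submodule.exists_linearMap_range_eq_mul {k A : Type*} [Field k] [Ring A] [Algebra k A]
    (M N : Submodule k A) [FiniteDimensional k M] [FiniteDimensional k N] :
    ∃ π : (Fin (Module.finrank k M * Module.finrank k N) → k) →ₗ[k] A,
      LinearMap.range π = M * N := by
  let b := (Module.finBasisOfFinrankEq k (TensorProduct k M N)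
    (Module.finrank_tensorProduct (R := k))).equivFun.symm
  refine ⟨M.mulMap N ∘ₗ b.toLinearMap, ?_⟩
  rw [LinearMap.range_comp, LinearEquiv.range, Submodule.map_top, Submodule.mulMap_range]

theorem Submodule.finrank_finset_sup_le {k M ι : Type*} [Field k] [AddCommGroup M] [Module k M]
    (s : Finset ι) (T : ι → Submodule k M) [∀ i, FiniteDimensional k (T i)] (c : ℕ)
    (h : ∀ i, Module.finrank k (T i) ≤ c) :
    Module.finrank k ↥(s.sup T) ≤ s.card * c := by
  induction s using Finset.induction_on with
  | empty => simp [Finset.sup_empty]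
  | insert a s ha ih =>
    rw [Finset.sup_insert, Finset.card_insert_of_notMem ha]
    refine (Submodule.finrank_add_le_finrank_add_finrank _ _).trans ?_
    have := h a
    linarith

/-- The middle coefficients of a single element of `G * M * H` span a subspace of `M` of
dimension at most `dim G * dim H`. -/
theorem Submodule.exists_mem_mul_mul_of_mem {k A : Type*} [Field k] [Ring A] [Algebra k A]
    (G M H : Submodule k A) [FiniteDimensional k G] [FiniteDimensional k H] {x : A}
    (hx : x ∈ G * M * H) :
    ∃ P ≤ M, FiniteDimensional k P ∧
      Module.finrank k P ≤ Module.finrank k G * Module.finrank k H ∧ x ∈ G * P * H := by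
  let b := Module.finBasis k G
  let c := Module.finBasis k H
  let g : (Fin (Module.finrank k G) × Fin (Module.finrank k H) → M) →ₗ[k] A :=
    ∑ p, LinearMap.mulLeftRight k ((b p.1 : A), (c p.2 : A)) ∘ₗ M.subtype ∘ₗ LinearMap.proj p
  have hg : ∀ m, g m = ∑ p, (b p.1 : A) * m p * c p.2 := by
    intro m
    simp [g, LinearMap.sum_apply, LinearMap.mulLeftRight_apply]
  have hle : G * M * H ≤ LinearMap.range g := by
    refine Submodule.mul_le.2 fun y hy w hw => ?_
    refine Submodule.mul_induction_on hy (fun u hu m hm => ?_) fun y z hy hz => ?_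
    · refine ⟨fun p => (b.repr ⟨u, hu⟩ p.1 * c.repr ⟨w, hw⟩ p.2) • ⟨m, hm⟩, ?_⟩
      have hu' : ((∑ i, b.repr ⟨u, hu⟩ i • b i : G) : A) = u :=
        congrArg Subtype.val (b.sum_repr ⟨u, hu⟩)
      have hw' : ((∑ i, c.repr ⟨w, hw⟩ i • c i : H) : A) = w :=
        congrArg Subtype.val (c.sum_repr ⟨w, hw⟩)
      rw [Submodule.coe_sum] at hu' hw'
      rw [hg, Fintype.sum_prod_type]
      conv_rhs => rw [← hu', ← hw', Finset.sum_mul, Finset.sum_mul]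
      refine Finset.sum_congr rfl fun i _ => ?_
      rw [Finset.mul_sum]
      refine Finset.sum_congr rfl fun j _ => ?_
      simp [smul_smul, mul_comm]
    · rw [add_mul]
      exact add_mem hy hz
  obtain ⟨m, rfl⟩ := hle hx
  refine ⟨Submodule.span k (Set.range fun p => (m p : A)), ?_, ?_, ?_, ?_⟩
  · rw [Submodule.span_le]
    rintro _ ⟨p, rfl⟩
    exact (m p).2
  · exact FiniteDimensional.span_of_finite k (Set.finite_range _)
  · refine (finrank_range_le_card (R := k) fun p => (m p : A)).trans_eq ?_
    rw [Fintype.card_prod, Fintype.card_fin, Fintype.card_fin]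
  · rw [hg]
    exact Submodule.sum_mem _ fun p _ => Submodule.mul_mem_mul (Submodule.mul_mem_mul (b p.1).2
      (Submodule.subset_span ⟨p, rfl⟩)) (c p.2).2

open TensorProduct in
/-- Given a linear map `π : W → A` into an algebra over an algebraically closed field, a small
subspace `F` of `W` and a small subspace `T` of `W ⊗ W`, some subspace of codimension two containing
`F` generates all products coming from `T`. -/
theorem exists_codim_two_forall_mem_mul_sup_mul {k A W : Type*} [Field k] [IsAlgClosed k] [Ring A]
    [Algebra k A] [AddCommGroup W] [Module k W] [FiniteDimensional k W] (π : W →ₗ[k] A)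
    (F : Submodule k W) (T : Submodule k (W ⊗[k] W))
    (h : 3 * Module.finrank k T + 1 + Module.finrank k F < Module.finrank k W) :
    ∃ Z : Submodule k W, F ≤ Z ∧ Module.finrank k Z + 2 = Module.finrank k W ∧
      ∀ τ ∈ T, LinearMap.mul' k A (TensorProduct.map π π τ) ∈
        Z.map π * LinearMap.range π ⊔ LinearMap.range π * Z.map π := by
  have hE := Subspace.finrank_add_finrank_dualAnnihilator_eq F
  let t := Module.finBasis k T
  let B : Fin (Module.finrank k T) → Module.Dual k W →ₗ[k] Module.Dual k W →ₗ[k] k := fun i =>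
    (TensorProduct.mk k (Module.Dual k W) (Module.Dual k W)).compr₂
      ((TensorProduct.dualDistrib k W W).flip (t i))
  obtain ⟨v, hv, hvB⟩ := LinearMap.exists_linearIndependent_common_isotropic
    (E := F.dualAnnihilator) (fun i => (B i).domRestrict₁₂ F.dualAnnihilator F.dualAnnihilator) (by
      rw [Fintype.card_fin]
      omega)
  let φ : Fin 2 → Module.Dual k W := fun a => v a
  have hφ : LinearIndependent k φ := hv.map' F.dualAnnihilator.subtype (Submodule.ker_subtype _)
  have hφB : ∀ τ ∈ T, ∀ a b, TensorProduct.dualDistrib k W W (φ a ⊗ₜ φ b) τ = 0 := by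
    intro τ hτ a b
    have hsum : ((∑ i, t.repr ⟨τ, hτ⟩ i • t i : T) : W ⊗[k] W) = τ :=
      congrArg Subtype.val (t.sum_repr ⟨τ, hτ⟩)
    rw [← hsum, Submodule.coe_sum, map_sum]
    refine Finset.sum_eq_zero fun i _ => ?_
    rw [Submodule.coe_smul, map_smul, show TensorProduct.dualDistrib k W W (φ a ⊗ₜ φ b) (t i) = 0
      from hvB i a b, smul_zero]
  have hsurj := hφ.surjective_pi
  choose w hw using fun a : Fin 2 => hsurj (Pi.single a 1)
  have hφw : ∀ a b, φ a (w b) = if a = b then 1 else 0 := by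
    intro a b
    have := congrFun (hw b) a
    simpa [Pi.single_apply] using this
  let s : W →ₗ[k] W := ∑ a, (φ a).smulRight (w a)
  have hs : ∀ x, s x = ∑ a, φ a x • w a := fun x => by simp [s]
  let q : W →ₗ[k] W := LinearMap.id - s
  have hqZ : ∀ x, q x ∈ LinearMap.ker (LinearMap.pi φ) := by
    intro x
    ext a
    fin_cases a <;> simp [q, hs, hφw]
  have hss : ∀ τ, TensorProduct.map s s τ =
      ∑ a, ∑ b, TensorProduct.dualDistrib k W W (φ a ⊗ₜ φ b) τ • (w a ⊗ₜ[k] w b) := by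
    intro τ
    induction τ with
    | zero => simp
    | tmul x y =>
      rw [TensorProduct.map_tmul, hs, hs, TensorProduct.sum_tmul]
      refine Finset.sum_congr rfl fun a _ => ?_
      rw [TensorProduct.tmul_sum]
      refine Finset.sum_congr rfl fun b _ => ?_
      rw [TensorProduct.smul_tmul_smul, TensorProduct.dualDistrib_apply]
    | add x y hx hy => simp only [map_add, hx, hy, add_smul, Finset.sum_add_distrib]
  refine ⟨LinearMap.ker (LinearMap.pi φ), fun x hx => ?_, ?_, fun τ hτ => ?_⟩
  · ext a
    exact (Submodule.mem_dualAnnihilator _).1 (v a).2 x hx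
  · have := (LinearMap.pi φ).finrank_range_add_finrank_ker
    rw [LinearMap.range_eq_top.2 hsurj] at this
    simp only [finrank_top, Module.finrank_fintype_fun_eq_card, Fintype.card_fin] at this
    omega
  · have h0 : TensorProduct.map s s τ = 0 := by simp [hss, hφB τ hτ]
    have hdec : τ = TensorProduct.map q LinearMap.id τ + TensorProduct.map s q τ := by
      have : τ = TensorProduct.map q LinearMap.id τ + TensorProduct.map s q τ +
          TensorProduct.map s s τ := by
        clear h0 hτ
        induction τ with
        | zero => simp
        | tmul x y =>
          simp only [TensorProduct.map_tmul, q, LinearMap.sub_apply, LinearMap.id_apply,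
            TensorProduct.tmul_sub, TensorProduct.sub_tmul]
          abel
        | add x y hx hy =>
          nth_rewrite 1 [hx, hy]
          simp only [map_add]
          abel
      rwa [h0, add_zero] at this
    have h1 : ∀ τ, LinearMap.mul' k A (TensorProduct.map π π (TensorProduct.map q LinearMap.id τ)) ∈
        (LinearMap.ker (LinearMap.pi φ)).map π * LinearMap.range π := by
      intro τ
      induction τ with
      | zero => simp
      | tmul x y =>
        simpa using Submodule.mul_mem_mul (Submodule.mem_map_of_mem (f := π) (hqZ x))
          (LinearMap.mem_range_self π y)
      | add x y hx hy => simpa only [map_add] using add_mem hx hy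
    have h2 : ∀ τ, LinearMap.mul' k A (TensorProduct.map π π (TensorProduct.map s q τ)) ∈
        LinearMap.range π * (LinearMap.ker (LinearMap.pi φ)).map π := by
      intro τ
      induction τ with
      | zero => simp
      | tmul x y =>
        simpa using Submodule.mul_mem_mul (LinearMap.mem_range_self π (s x))
          (Submodule.mem_map_of_mem (f := π) (hqZ y))
      | add x y hx hy => simpa only [map_add] using add_mem hx hy
    rw [hdec, map_add, map_add]
    exact add_mem (Submodule.mem_sup_left (h1 τ)) (Submodule.mem_sup_right (h2 τ))

section HomogeneousComponents

theorem Adeg_zero : Adeg K 0 = 1 := by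
  rw [Adeg, Submodule.one_eq_span]
  congr 1
  ext m
  simp [Mon]

theorem Adeg_mul_Adeg (a b : ℕ) : Adeg K a * Adeg K b = Adeg K (a + b) := by
  rw [Adeg, Adeg, Adeg, Submodule.span_mul_span]
  congr 1
  ext m
  constructor
  · rintro ⟨_, ⟨u, hu, rfl⟩, _, ⟨v, hv, rfl⟩, rfl⟩
    exact ⟨u ++ v, by simp [hu, hv], by simp⟩
  · rintro ⟨w, hw, rfl⟩
    refine ⟨_, ⟨w.take a, by simp; omega, rfl⟩, _, ⟨w.drop a, by simp; omega, rfl⟩, ?_⟩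
    simp only
    rw [← List.prod_append, ← List.map_append, List.take_append_drop]

instance finiteDimensional_Adeg (k : ℕ) : FiniteDimensional K (Adeg K k) := by
  refine FiniteDimensional.span_of_finite K ?_
  refine ((List.finite_length_eq (Fin 2) k).image
    fun w => (w.map (FreeAlgebra.ι K)).prod).subset ?_
  rintro _ ⟨w, hw, rfl⟩
  exact ⟨w, hw, rfl⟩

/-- Projection of the free algebra onto its homogeneous component of degree `k`. -/
theorem exists_homogeneous_projection (k : ℕ) :
    ∃ P : FA K →ₗ[K] FA K, ∀ m, ∀ x ∈ Adeg K m, P x = if m = k then x else 0 := by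
  let φ : FA K →ₐ[K] Polynomial (FA K) :=
    FreeAlgebra.lift K fun i => Polynomial.C (FreeAlgebra.ι K i) * Polynomial.X
  have hφ : ∀ w : List (Fin 2), φ (w.map (FreeAlgebra.ι K)).prod =
      Polynomial.C (w.map (FreeAlgebra.ι K)).prod * Polynomial.X ^ w.length := by
    intro w
    induction w with
    | nil => simp
    | cons a w ih =>
      rw [List.map_cons, List.prod_cons, map_mul, ih, List.length_cons, pow_succ', map_mul]
      simp only [φ, FreeAlgebra.lift_ι_apply]
      rw [mul_assoc, ← mul_assoc Polynomial.X, Polynomial.X_mul_C, mul_assoc, mul_assoc]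
  refine ⟨(Polynomial.lcoeff (FA K) k).restrictScalars K ∘ₗ φ.toLinearMap, fun m x hx => ?_⟩
  induction hx using Submodule.span_induction with
  | mem x hx =>
    obtain ⟨w, hw, rfl⟩ := hx
    simp [hφ, hw, Polynomial.coeff_C_mul, Polynomial.coeff_X_pow, eq_comm]
  | zero => simp
  | add x y _ _ hx hy =>
    rw [map_add, hx, hy]
    split_ifs <;> simp
  | smul c x _ hx =>
    rw [map_smul, hx]
    split_ifs <;> simp

theorem iSup_Adeg : ⨆ k, Adeg K k = ⊤ := by
  rw [eq_top_iff]
  intro x _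
  induction x using FreeAlgebra.induction with
  | grade0 r =>
    refine Submodule.mem_iSup_of_mem 0 ?_
    rw [Adeg_zero]
    exact Submodule.algebraMap_mem r
  | grade1 i => exact Submodule.mem_iSup_of_mem 1 (Submodule.subset_span ⟨[i], rfl, by simp⟩)
  | mul a b ha hb =>
    have := Submodule.mul_mem_mul (ha trivial) (hb trivial)
    refine (?_ : (⨆ k, Adeg K k) * (⨆ k, Adeg K k) ≤ ⨆ k, Adeg K k) this
    rw [Submodule.iSup_mul]
    refine iSup_le fun i => ?_
    rw [Submodule.mul_iSup]
    refine iSup_le fun j => ?_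
    rw [Adeg_mul_Adeg]
    exact le_iSup (Adeg K) (i + j)
  | add a b ha hb => exact add_mem (ha trivial) (hb trivial)

/-- A homogeneous component of the ideal generated by a homogeneous `f` is spanned by the
homogeneous multiples of `f` of that degree. -/
theorem ideal_inf_Adeg_le {f : FA K} {k N : ℕ} (hf : f ∈ Adeg K k) {Q : Submodule K (FA K)}
    (hQ : ∀ i j, i + k + j = N → Adeg K i * Submodule.span K {f} * Adeg K j ≤ Q) :
    (⊤ : Submodule K (FA K)) * Submodule.span K {f} * ⊤ ⊓ Adeg K N ≤ Q := by
  obtain ⟨P, hP⟩ := exists_homogeneous_projection K N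
  have h : (⊤ : Submodule K (FA K)) * Submodule.span K {f} * ⊤ ≤ Q.comap P := by
    rw [← iSup_Adeg, Submodule.iSup_mul, Submodule.iSup_mul]
    refine iSup_le fun i => ?_
    rw [Submodule.mul_iSup]
    refine iSup_le fun j => ?_
    intro x hx
    have hfk : Submodule.span K {f} ≤ Adeg K k := by simpa using hf
    have hx' : x ∈ Adeg K (i + k + j) := by
      rw [← Adeg_mul_Adeg, ← Adeg_mul_Adeg]
      exact mul_le_mul' (mul_le_mul' le_rfl hfk) le_rfl hx
    rw [Submodule.mem_comap, hP _ x hx']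
    split_ifs with hN
    · exact hQ i j hN hx
    · exact Q.zero_mem
  rintro x ⟨hx, hxN⟩
  have := h hx
  rwa [Submodule.mem_comap, hP _ x hxN, if_pos rfl] at this

/-- The compatibility of the spaces `U(2^m)`, `m < n`, with multiplication by homogeneous
components. -/
def UMulStable (U : ℕ → Submodule K (FA K)) (n : ℕ) : Prop :=
  ∀ m, m + 1 < n → Adeg K (2 ^ m) * U m ≤ U (m + 1) ∧ U m * Adeg K (2 ^ m) ≤ U (m + 1)

variable {K} {U : ℕ → Submodule K (FA K)} {n : ℕ}

theorem UMulStable.Adeg_mul_mul_Adeg_le (hU : UMulStable K U n) (p s : ℕ) :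
    ∀ a b, a + b + 1 = 2 ^ s → p + s < n →
      Adeg K (a * 2 ^ p) * U p * Adeg K (b * 2 ^ p) ≤ U (p + s) := by
  induction s with
  | zero =>
    intro a b hab _
    obtain ⟨rfl, rfl⟩ : a = 0 ∧ b = 0 := by constructor <;> simp at hab <;> omega
    simp [Adeg_zero]
  | succ s ih =>
    intro a b hab hs
    rw [pow_succ] at hab
    have hpow : 2 ^ s * 2 ^ p = 2 ^ (p + s) := by rw [pow_add, mul_comm]
    obtain hlt | hge := lt_or_ge a (2 ^ s)
    · obtain ⟨c, rfl⟩ : ∃ c, b = c + 2 ^ s := ⟨b - 2 ^ s, by omega⟩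
      rw [add_mul, hpow, ← Adeg_mul_Adeg, ← mul_assoc]
      exact (mul_le_mul' (ih a c (by omega) (by omega)) le_rfl).trans (hU _ (by omega)).2
    · obtain ⟨c, rfl⟩ : ∃ c, a = 2 ^ s + c := ⟨a - 2 ^ s, by omega⟩
      rw [add_mul, hpow, ← Adeg_mul_Adeg, mul_assoc, mul_assoc, ← mul_assoc (Adeg K (c * 2 ^ p))]
      exact (mul_le_mul' le_rfl (ih c b (by omega) (by omega))).trans (hU _ (by omega)).1

theorem exists_eq_of_testBit {i p N : ℕ} (hp : i.testBit p) (hi : i ≤ 2 ^ N) :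
    ∃ s a b, N = p + s ∧ a + b + 1 = 2 ^ s ∧ i - i % 2 ^ p - 2 ^ p = a * 2 ^ p ∧
      i % 2 ^ p + (2 ^ N - i) = b * 2 ^ p := by
  have hpN : p ≤ N :=
    (Nat.pow_le_pow_iff_right one_lt_two).1 ((Nat.ge_two_pow_of_testBit hp).trans hi)
  obtain ⟨s, rfl⟩ := Nat.exists_eq_add_of_le hpN
  have hdiv := Nat.div_add_mod i (2 ^ p)
  have h1 : 1 ≤ i / 2 ^ p := (Nat.one_le_div_iff (by positivity)).2 (Nat.ge_two_pow_of_testBit hp)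
  have h2 : i / 2 ^ p ≤ 2 ^ s := by
    refine Nat.div_le_of_le_mul ?_
    rwa [← pow_add]
  obtain ⟨a, ha⟩ := Nat.exists_eq_add_of_le h1
  obtain ⟨b, hb⟩ := Nat.exists_eq_add_of_le h2
  rw [ha] at hdiv hb
  refine ⟨s, a, b, rfl, by omega, ?_, ?_⟩
  · have : 2 ^ p * (1 + a) = a * 2 ^ p + 2 ^ p := by ring
    omega
  · have : 2 ^ (p + s) = 2 ^ p * (1 + a) + b * 2 ^ p := by rw [pow_add, hb]; ring
    omega

theorem UMulStable.Ugt_mul_Adeg_le (hU : UMulStable K U n) {N i : ℕ} (hN : N < n)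
    (hi : i ≤ 2 ^ N) : Ugt K U i * Adeg K (2 ^ N - i) ≤ U N := by
  rw [Ugt, Submodule.iSup_mul]
  refine iSup_le fun p => ?_
  rw [Submodule.iSup_mul]
  refine iSup_le fun hp => ?_
  obtain ⟨s, a, b, rfl, hab, ha, hb⟩ := exists_eq_of_testBit hp hi
  rw [mul_assoc, Adeg_mul_Adeg, ha, hb]
  exact hU.Adeg_mul_mul_Adeg_le p s a b hab hN

theorem UMulStable.Adeg_mul_Ult_le (hU : UMulStable K U n) {N i : ℕ} (hN : N < n)
    (hi : i ≤ 2 ^ N) : Adeg K (2 ^ N - i) * Ult K U i ≤ U N := by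
  rw [Ult, Submodule.mul_iSup]
  refine iSup_le fun p => ?_
  rw [Submodule.mul_iSup]
  refine iSup_le fun hp => ?_
  obtain ⟨s, a, b, rfl, hab, ha, hb⟩ := exists_eq_of_testBit hp hi
  rw [mul_assoc, ← mul_assoc, Adeg_mul_Adeg, ← mul_assoc, add_comm, ha, hb]
  exact hU.Adeg_mul_mul_Adeg_le p s b a (by omega) hN

/-- The exponent bounding the codimension of `U^<(i)` and `U^>(i)` in `A(i)`, when `V(2^p)` has
dimension at most `2 ^ w p`. -/
def bitWeight (w : ℕ → ℕ) (N i : ℕ) : ℕ :=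
  ∑ p ∈ Finset.range N, if i.testBit p then w p else 0

theorem bitWeight_succ_of_lt (w : ℕ → ℕ) {N i : ℕ} (hi : i < 2 ^ N) :
    bitWeight w (N + 1) i = bitWeight w N i := by
  simp [bitWeight, Finset.sum_range_succ, Nat.testBit_lt_two_pow hi]

theorem bitWeight_succ_two_pow_add (w : ℕ → ℕ) {N i : ℕ} (hi : i < 2 ^ N) :
    bitWeight w (N + 1) (2 ^ N + i) = bitWeight w N i + w N := by
  rw [bitWeight, Finset.sum_range_succ, Nat.testBit_two_pow_add_eq, Nat.testBit_lt_two_pow hi]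
  simp only [Bool.not_false, if_true, bitWeight, Nat.add_right_cancel_iff]
  refine Finset.sum_congr rfl fun p hp => ?_
  rw [Nat.testBit_two_pow_add_gt (Finset.mem_range.1 hp)]

theorem mod_two_pow_add_two_pow_le {p i : ℕ} (h : 2 ^ p ≤ i) : i % 2 ^ p + 2 ^ p ≤ i := by
  have h1 : 1 ≤ i / 2 ^ p := (Nat.one_le_div_iff (by positivity)).2 h
  have h2 := Nat.div_add_mod i (2 ^ p)
  have h3 := Nat.mul_le_mul_left (2 ^ p) h1
  omega

theorem Ugt_two_pow_add_ge {N i : ℕ} (hi : i < 2 ^ N) :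
    U N * Adeg K i ⊔ Adeg K (2 ^ N) * Ugt K U i ≤ Ugt K U (2 ^ N + i) := by
  refine sup_le ?_ ?_
  · refine le_trans ?_ (le_iSup₂_of_le N (by simp [Nat.testBit_two_pow_add_eq,
      Nat.testBit_lt_two_pow hi]) le_rfl)
    rw [Nat.add_mod_left, Nat.mod_eq_of_lt hi, Nat.add_sub_cancel, Nat.sub_self, Adeg_zero, one_mul]
  · rw [Ugt, Submodule.mul_iSup]
    refine iSup_le fun p => ?_
    rw [Submodule.mul_iSup]
    refine iSup_le fun hp => ?_
    have hpi := Nat.ge_two_pow_of_testBit hp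
    have hpN : p < N := (Nat.pow_lt_pow_iff_right one_lt_two).1 (hpi.trans_lt hi)
    refine le_trans ?_ (le_iSup₂_of_le p (by rwa [Nat.testBit_two_pow_add_gt hpN]) le_rfl)
    have hmod : (2 ^ N + i) % 2 ^ p = i % 2 ^ p := by
      rw [Nat.add_mod, Nat.mod_eq_zero_of_dvd (pow_dvd_pow 2 hpN.le), zero_add, Nat.mod_mod]
    have hle := mod_two_pow_add_two_pow_le hpi
    rw [hmod, ← mul_assoc, ← mul_assoc, Adeg_mul_Adeg,
      show 2 ^ N + (i - i % 2 ^ p - 2 ^ p) = 2 ^ N + i - i % 2 ^ p - 2 ^ p by omega]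

theorem Ult_two_pow_add_ge {N i : ℕ} (hi : i < 2 ^ N) :
    Adeg K i * U N ⊔ Ult K U i * Adeg K (2 ^ N) ≤ Ult K U (2 ^ N + i) := by
  refine sup_le ?_ ?_
  · refine le_trans ?_ (le_iSup₂_of_le N (by simp [Nat.testBit_two_pow_add_eq,
      Nat.testBit_lt_two_pow hi]) le_rfl)
    rw [Nat.add_mod_left, Nat.mod_eq_of_lt hi, Nat.add_sub_cancel, Nat.sub_self, Adeg_zero, mul_one]
  · rw [Ult, Submodule.iSup_mul]
    refine iSup_le fun p => ?_
    rw [Submodule.iSup_mul]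
    refine iSup_le fun hp => ?_
    have hpi := Nat.ge_two_pow_of_testBit hp
    have hpN : p < N := (Nat.pow_lt_pow_iff_right one_lt_two).1 (hpi.trans_lt hi)
    refine le_trans ?_ (le_iSup₂_of_le p (by rwa [Nat.testBit_two_pow_add_gt hpN]) le_rfl)
    have hmod : (2 ^ N + i) % 2 ^ p = i % 2 ^ p := by
      rw [Nat.add_mod, Nat.mod_eq_zero_of_dvd (pow_dvd_pow 2 hpN.le), zero_add, Nat.mod_mod]
    have hle := mod_two_pow_add_two_pow_le hpi
    rw [hmod, mul_assoc, Adeg_mul_Adeg,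
      show i - i % 2 ^ p - 2 ^ p + 2 ^ N = 2 ^ N + i - i % 2 ^ p - 2 ^ p by omega]

/-- `U^>(i)` has a small supplement in `A(i)`. -/
theorem exists_Adeg_le_Ugt_sup {V : ℕ → Submodule K (FA K)} {w : ℕ → ℕ}
    (hVA : ∀ p < n, V p ≤ Adeg K (2 ^ p)) (hVU : ∀ p < n, Adeg K (2 ^ p) ≤ V p ⊔ U p)
    (hw : ∀ p < n, Module.finrank K (V p) ≤ 2 ^ w p) :
    ∀ N ≤ n, ∀ i < 2 ^ N, ∃ G ≤ Adeg K i, Module.finrank K G ≤ 2 ^ bitWeight w N i ∧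
      Adeg K i ≤ Ugt K U i ⊔ G := by
  intro N
  induction N with
  | zero =>
    intro _ i hi
    obtain rfl : i = 0 := by simpa using hi
    refine ⟨Adeg K 0, le_rfl, ?_, le_sup_right⟩
    rw [Adeg_zero, Submodule.one_eq_span]
    simpa [bitWeight] using finrank_span_le_card (R := K) ({1} : Set (FA K))
  | succ N ih =>
    intro hN i hi
    obtain hlt | hge := lt_or_ge i (2 ^ N)
    · rw [bitWeight_succ_of_lt w hlt]
      exact ih (by omega) i hlt
    · obtain ⟨j, rfl⟩ := Nat.exists_eq_add_of_le hge
      have hj : j < 2 ^ N := by rw [pow_succ] at hi; omega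
      obtain ⟨G, hGA, hG, hUG⟩ := ih (by omega) j hj
      have := Submodule.finiteDimensional_of_le hGA
      have := Submodule.finiteDimensional_of_le (hVA N (by omega))
      refine ⟨V N * G, ?_, ?_, ?_⟩
      · rw [← Adeg_mul_Adeg]
        exact mul_le_mul' (hVA N (by omega)) hGA
      · rw [bitWeight_succ_two_pow_add w hj, add_comm, pow_add]
        exact (Submodule.finrank_mul_le _ _).trans (Nat.mul_le_mul (hw N (by omega)) hG)
      · refine le_trans ?_ (sup_le_sup_right (Ugt_two_pow_add_ge hj) _)
        rw [← Adeg_mul_Adeg]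
        calc Adeg K (2 ^ N) * Adeg K j ≤ V N * Adeg K j ⊔ U N * Adeg K j := by
              rw [← Submodule.sup_mul]
              exact mul_le_mul' (hVU N (by omega)) le_rfl
          _ ≤ V N * (Ugt K U j ⊔ G) ⊔ U N * Adeg K j :=
              sup_le_sup_right (mul_le_mul' le_rfl hUG) _
          _ ≤ _ := by
              rw [Submodule.mul_sup]
              refine sup_le (sup_le ?_ le_sup_right) (le_sup_of_le_left le_sup_left)
              exact le_sup_of_le_left (le_sup_of_le_right (mul_le_mul' (hVA N (by omega)) le_rfl))

/-- `U^<(i)` has a small supplement in `A(i)`. -/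
theorem exists_Adeg_le_Ult_sup {V : ℕ → Submodule K (FA K)} {w : ℕ → ℕ}
    (hVA : ∀ p < n, V p ≤ Adeg K (2 ^ p)) (hVU : ∀ p < n, Adeg K (2 ^ p) ≤ V p ⊔ U p)
    (hw : ∀ p < n, Module.finrank K (V p) ≤ 2 ^ w p) :
    ∀ N ≤ n, ∀ i < 2 ^ N, ∃ G ≤ Adeg K i, Module.finrank K G ≤ 2 ^ bitWeight w N i ∧
      Adeg K i ≤ Ult K U i ⊔ G := by
  intro N
  induction N with
  | zero =>
    intro _ i hi
    obtain rfl : i = 0 := by simpa using hi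
    refine ⟨Adeg K 0, le_rfl, ?_, le_sup_right⟩
    rw [Adeg_zero, Submodule.one_eq_span]
    simpa [bitWeight] using finrank_span_le_card (R := K) ({1} : Set (FA K))
  | succ N ih =>
    intro hN i hi
    obtain hlt | hge := lt_or_ge i (2 ^ N)
    · rw [bitWeight_succ_of_lt w hlt]
      exact ih (by omega) i hlt
    · obtain ⟨j, rfl⟩ := Nat.exists_eq_add_of_le hge
      have hj : j < 2 ^ N := by rw [pow_succ] at hi; omega
      obtain ⟨G, hGA, hG, hUG⟩ := ih (by omega) j hj
      have := Submodule.finiteDimensional_of_le hGA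
      have := Submodule.finiteDimensional_of_le (hVA N (by omega))
      refine ⟨G * V N, ?_, ?_, ?_⟩
      · rw [add_comm, ← Adeg_mul_Adeg]
        exact mul_le_mul' hGA (hVA N (by omega))
      · rw [bitWeight_succ_two_pow_add w hj, pow_add]
        exact (Submodule.finrank_mul_le _ _).trans (Nat.mul_le_mul hG (hw N (by omega)))
      · refine le_trans ?_ (sup_le_sup_right (Ult_two_pow_add_ge hj) _)
        rw [add_comm, ← Adeg_mul_Adeg]
        calc Adeg K j * Adeg K (2 ^ N) ≤ Adeg K j * V N ⊔ Adeg K j * U N := by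
              rw [← Submodule.mul_sup]
              exact mul_le_mul' le_rfl (hVU N (by omega))
          _ ≤ (Ult K U j ⊔ G) * V N ⊔ Adeg K j * U N :=
              sup_le_sup_right (mul_le_mul' hUG le_rfl) _
          _ ≤ _ := by
              rw [Submodule.sup_mul]
              refine sup_le (sup_le ?_ le_sup_right) (le_sup_of_le_left le_sup_left)
              exact le_sup_of_le_left (le_sup_of_le_right (mul_le_mul' le_rfl (hVA N (by omega))))

variable {V : ℕ → Submodule K (FA K)}

theorem exists_nonzero_mem_Adeg (k : ℕ) : ∃ x ∈ Adeg K k, x ≠ 0 := by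
  refine ⟨FreeAlgebra.ι K 0 ^ k, Submodule.subset_span ⟨List.replicate k 0, by simp, by simp⟩, ?_⟩
  intro h
  have := congrArg (FreeAlgebra.lift K fun _ => (1 : K)) h
  simp at this

/-- A small middle coefficient space for a homogeneous element of degree `i + N + j`. -/
theorem exists_middle_space {w : ℕ → ℕ}
    (hVA : ∀ p < n, V p ≤ Adeg K (2 ^ p)) (hVU : ∀ p < n, Adeg K (2 ^ p) ≤ V p ⊔ U p)
    (hw : ∀ p < n, Module.finrank K (V p) ≤ 2 ^ w p) {i j N : ℕ} (hi : i < 2 ^ n) (hj : j < 2 ^ n)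
    {f : FA K} (hf : f ∈ Adeg K (i + N + j)) :
    ∃ P ≤ Adeg K N, Module.finrank K P ≤ 2 ^ (bitWeight w n i + bitWeight w n j) ∧
      f ∈ Adeg K i * P * Adeg K j ⊔ Ult K U i * Adeg K (N + j) ⊔ Adeg K (i + N) * Ugt K U j := by
  obtain ⟨G, hGA, hG, hUG⟩ := exists_Adeg_le_Ult_sup hVA hVU hw n le_rfl i hi
  obtain ⟨H, hHA, hH, hUH⟩ := exists_Adeg_le_Ugt_sup hVA hVU hw n le_rfl j hj
  have := Submodule.finiteDimensional_of_le hGA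
  have := Submodule.finiteDimensional_of_le hHA
  have hle : Adeg K (i + N + j) ≤
      G * Adeg K N * H ⊔ (Ult K U i * Adeg K (N + j) ⊔ Adeg K (i + N) * Ugt K U j) := by
    rw [← Adeg_mul_Adeg, ← Adeg_mul_Adeg]
    calc Adeg K i * Adeg K N * Adeg K j
        ≤ (Ult K U i ⊔ G) * Adeg K N * Adeg K j := mul_le_mul' (mul_le_mul' hUG le_rfl) le_rfl
      _ = Ult K U i * Adeg K (N + j) ⊔ G * Adeg K N * Adeg K j := by
          rw [Submodule.sup_mul, Submodule.sup_mul, mul_assoc, Adeg_mul_Adeg]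
      _ ≤ Ult K U i * Adeg K (N + j) ⊔ G * Adeg K N * (Ugt K U j ⊔ H) :=
          sup_le_sup_left (mul_le_mul' le_rfl hUH) _
      _ ≤ _ := by
          rw [Submodule.mul_sup]
          refine sup_le (le_sup_of_le_right le_sup_left) (sup_le ?_ le_sup_left)
          refine le_sup_of_le_right (le_sup_of_le_right ?_)
          exact mul_le_mul' (mul_le_mul' hGA le_rfl) le_rfl
  obtain ⟨x, hx, y, hy, rfl⟩ := Submodule.mem_sup.1 (hle hf)
  obtain ⟨P, hPA, _, hP, hxP⟩ := Submodule.exists_mem_mul_mul_of_mem G (Adeg K N) H hx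
  refine ⟨P, hPA, ?_, ?_⟩
  · rw [pow_add]
    exact hP.trans (Nat.mul_le_mul hG hH)
  · rw [sup_assoc]
    exact add_mem (Submodule.mem_sup_left (mul_le_mul' (mul_le_mul' hGA le_rfl) hHA hxP))
      (Submodule.mem_sup_right hy)

/-- Modulo the ideals generated by `U`, the multiples `A(i) f A(j)` span a small space. -/
theorem UMulStable.exists_multiples_space (hU : UMulStable K U n) {w : ℕ → ℕ}
    (hVA : ∀ p < n, V p ≤ Adeg K (2 ^ p)) (hVU : ∀ p < n, Adeg K (2 ^ p) ≤ V p ⊔ U p)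
    (hw : ∀ p < n, Module.finrank K (V p) ≤ 2 ^ w p) {N i j k M : ℕ} (hN : N < n)
    (hi : i ≤ 2 ^ N) (hj : j ≤ 2 ^ N) (hk : i + k + j = 2 ^ N + M)
    {f : FA K} (hf : f ∈ Adeg K k) :
    ∃ T ≤ Adeg K (2 ^ N + M),
      Module.finrank K T ≤ 2 ^ (bitWeight w n i + bitWeight w n j) ∧
      Adeg K i * Submodule.span K {f} * Adeg K j ≤ T ⊔ (U N * Adeg K M ⊔ Adeg K M * U N) := by
  have hlt : 2 ^ N < 2 ^ n := Nat.pow_lt_pow_right one_lt_two hN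
  obtain ⟨G, hGA, hG, hUG⟩ := exists_Adeg_le_Ugt_sup hVA hVU hw n le_rfl i (by omega)
  obtain ⟨H, hHA, hH, hUH⟩ := exists_Adeg_le_Ult_sup hVA hVU hw n le_rfl j (by omega)
  have := Submodule.finiteDimensional_of_le hGA
  have := Submodule.finiteDimensional_of_le hHA
  have hfk : Submodule.span K {f} ≤ Adeg K k := by simpa using hf
  refine ⟨G * Submodule.span K {f} * H, ?_, ?_, ?_⟩
  · rw [← hk, ← Adeg_mul_Adeg, ← Adeg_mul_Adeg]
    exact mul_le_mul' (mul_le_mul' hGA hfk) hHA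
  · have h1 : Module.finrank K (Submodule.span K {f}) ≤ 1 := by
      simpa using finrank_span_le_card (R := K) ({f} : Set (FA K))
    have h2 := (Submodule.finrank_mul_le G (Submodule.span K {f})).trans
      (Nat.mul_le_mul hG h1)
    have h3 : FiniteDimensional K ↥(G * Submodule.span K {f}) :=
      Submodule.finiteDimensional_of_le (mul_le_mul' hGA hfk |>.trans (Adeg_mul_Adeg K i k).le)
    rw [mul_one] at h2
    rw [pow_add]
    exact (Submodule.finrank_mul_le _ _).trans (Nat.mul_le_mul h2 hH)
  · have hleft : Ugt K U i * Submodule.span K {f} * Adeg K j ≤ U N * Adeg K M := by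
      calc Ugt K U i * Submodule.span K {f} * Adeg K j
          ≤ Ugt K U i * Adeg K k * Adeg K j := mul_le_mul' (mul_le_mul' le_rfl hfk) le_rfl
        _ = Ugt K U i * Adeg K (2 ^ N - i) * Adeg K M := by
            rw [mul_assoc, mul_assoc, Adeg_mul_Adeg, Adeg_mul_Adeg,
              show k + j = 2 ^ N - i + M by omega]
        _ ≤ _ := mul_le_mul' (hU.Ugt_mul_Adeg_le hN hi) le_rfl
    have hright : Adeg K i * Submodule.span K {f} * Ult K U j ≤ Adeg K M * U N := by
      calc Adeg K i * Submodule.span K {f} * Ult K U j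
          ≤ Adeg K i * Adeg K k * Ult K U j := mul_le_mul' (mul_le_mul' le_rfl hfk) le_rfl
        _ = Adeg K M * (Adeg K (2 ^ N - j) * Ult K U j) := by
            rw [← mul_assoc, Adeg_mul_Adeg, Adeg_mul_Adeg,
              show i + k = M + (2 ^ N - j) by omega]
        _ ≤ _ := mul_le_mul' le_rfl (hU.Adeg_mul_Ult_le hN hj)
    calc Adeg K i * Submodule.span K {f} * Adeg K j
        ≤ (Ugt K U i ⊔ G) * Submodule.span K {f} * Adeg K j :=
          mul_le_mul' (mul_le_mul' hUG le_rfl) le_rfl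
      _ = Ugt K U i * Submodule.span K {f} * Adeg K j ⊔ G * Submodule.span K {f} * Adeg K j := by
          rw [Submodule.sup_mul, Submodule.sup_mul]
      _ ≤ Ugt K U i * Submodule.span K {f} * Adeg K j ⊔
            G * Submodule.span K {f} * (Ult K U j ⊔ H) :=
          sup_le_sup_left (mul_le_mul' le_rfl hUH) _
      _ ≤ _ := by
          rw [Submodule.mul_sup]
          refine sup_le (hleft.trans (le_sup_of_le_right le_sup_left)) (sup_le ?_ le_sup_left)
          refine le_sup_of_le_right (le_sup_of_le_right (le_trans ?_ hright))
          exact mul_le_mul' (mul_le_mul' hGA le_rfl) le_rfl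

/-- The part of `A(2^(m+2))` generated by `U(2^m)` at positions that are multiples of `2^m`. -/
def blockIdeal (U : ℕ → Submodule K (FA K)) (m : ℕ) : Submodule K (FA K) :=
  Adeg K (2 ^ m) * U m * Adeg K (2 ^ (m + 1)) ⊔ Adeg K (2 ^ (m + 1)) * U m * Adeg K (2 ^ m) ⊔
    U m * Adeg K (2 ^ (m + 1) + 2 ^ m) ⊔ Adeg K (2 ^ (m + 1) + 2 ^ m) * U m

theorem Adeg_two_pow_succ_le {m : ℕ} (hVA : V m ≤ Adeg K (2 ^ m))
    (hVU : Adeg K (2 ^ m) ≤ V m ⊔ U m) :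
    Adeg K (2 ^ (m + 1)) ≤ V m * V m ⊔ (U m * Adeg K (2 ^ m) ⊔ Adeg K (2 ^ m) * U m) := by
  have h2 : 2 ^ (m + 1) = 2 ^ m + 2 ^ m := by ring
  rw [h2, ← Adeg_mul_Adeg]
  calc Adeg K (2 ^ m) * Adeg K (2 ^ m) ≤ (V m ⊔ U m) * Adeg K (2 ^ m) := mul_le_mul' hVU le_rfl
    _ = V m * Adeg K (2 ^ m) ⊔ U m * Adeg K (2 ^ m) := Submodule.sup_mul _ _ _
    _ ≤ V m * (V m ⊔ U m) ⊔ U m * Adeg K (2 ^ m) := sup_le_sup_right (mul_le_mul' le_rfl hVU) _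
    _ ≤ _ := by
      rw [Submodule.mul_sup]
      refine sup_le (sup_le le_sup_left ?_) (le_sup_of_le_right le_sup_left)
      exact le_sup_of_le_right (le_sup_of_le_right (mul_le_mul' hVA le_rfl))

theorem Adeg_two_pow_add_two_le {m : ℕ} (hVA : V m ≤ Adeg K (2 ^ m))
    (hVU : Adeg K (2 ^ m) ≤ V m ⊔ U m) :
    Adeg K (2 ^ (m + 2)) ≤ V m * V m * (V m * V m) ⊔ blockIdeal U m := by
  have h2 : 2 ^ (m + 1) = 2 ^ m + 2 ^ m := by ring
  have h4 : 2 ^ (m + 2) = 2 ^ (m + 1) + 2 ^ (m + 1) := by ring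
  have hVV : V m * V m ≤ Adeg K (2 ^ (m + 1)) := by
    rw [h2, ← Adeg_mul_Adeg]
    exact mul_le_mul' hVA hVA
  have hA := Adeg_two_pow_succ_le hVA hVU
  rw [h4, ← Adeg_mul_Adeg]
  refine (mul_le_mul' hA le_rfl).trans ?_
  rw [Submodule.sup_mul, Submodule.sup_mul]
  have e1 : U m * Adeg K (2 ^ m) * Adeg K (2 ^ (m + 1)) = U m * Adeg K (2 ^ (m + 1) + 2 ^ m) := by
    rw [mul_assoc, Adeg_mul_Adeg, add_comm]
  have e2 : V m * V m * (Adeg K (2 ^ m) * U m) ≤ Adeg K (2 ^ (m + 1) + 2 ^ m) * U m := by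
    rw [← mul_assoc, ← Adeg_mul_Adeg]
    exact mul_le_mul' (mul_le_mul' hVV le_rfl) le_rfl
  have e3 : V m * V m * (U m * Adeg K (2 ^ m)) ≤ Adeg K (2 ^ (m + 1)) * U m * Adeg K (2 ^ m) := by
    rw [← mul_assoc]
    exact mul_le_mul' (mul_le_mul' hVV le_rfl) le_rfl
  refine sup_le ?_ (sup_le ?_ ?_)
  · refine (mul_le_mul' le_rfl hA).trans ?_
    rw [Submodule.mul_sup, Submodule.mul_sup]
    refine sup_le le_sup_left (le_sup_of_le_right (sup_le (e3.trans ?_) (e2.trans ?_)))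
    · exact le_sup_of_le_left (le_sup_of_le_left le_sup_right)
    · exact le_sup_right
  · rw [e1]
    exact le_sup_of_le_right (le_sup_of_le_left le_sup_right)
  · exact le_sup_of_le_right (le_sup_of_le_left (le_sup_of_le_left le_sup_left))

open TensorProduct in
/-- The two spaces of relations, for abstract bounds on the dimensions of the spaces `V(2^p)`. -/
theorem UMulStable.exists_relation_spaces [IsAlgClosed K] {ι : Type*} {m q c : ℕ}
    (hU : UMulStable K U (m + 1)) {w : ℕ → ℕ}
    (hVA : ∀ p < m + 1, V p ≤ Adeg K (2 ^ p)) (hVU : ∀ p < m + 1, Adeg K (2 ^ p) ≤ V p ⊔ U p)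
    (hw : ∀ p < m + 1, Module.finrank K (V p) ≤ 2 ^ w p)
    (J : Finset ι) (hJ : J.Nonempty) (f : ι → FA K) (d : ι → ℕ) (hf : ∀ j, f j ∈ Adeg K (d j))
    (hd : ∀ j ∈ J, 2 ^ (m + 1) + 2 ^ m ≤ d j ∧ d j ≤ 2 ^ (m + 1) + q)
    (hq : q < 2 ^ (m + 1))
    (hc : ∀ i j, i + j ≤ q → bitWeight w (m + 1) i + bitWeight w (m + 1) j ≤ c)
    (hdim : 16 * (J.card * 2 ^ (m + 1) * 2 ^ c) ≤ Module.finrank K (V m) ^ 2) :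
    ∃ F' Fn : Submodule K (FA K), F' ≤ Adeg K (2 ^ (m + 1)) ∧ Fn ≤ Adeg K (2 ^ (m + 1)) ∧
      F' ≠ ⊥ ∧ 2 * Module.finrank K F' ≤ Module.finrank K (V m) ^ 2 ∧
      (∀ j ∈ J, ∀ i i', i + i' = d j - 2 ^ (m + 1) →
        f j ∈ Adeg K i * F' * Adeg K i' ⊔ Ult K U i * Adeg K (d j - i) ⊔
          Adeg K (d j - i') * Ugt K U i') ∧
      Module.finrank K Fn + 2 ≤ Module.finrank K (V m) ^ 2 ∧
      F' ≤ Fn ⊔ (U m * Adeg K (2 ^ m) ⊔ Adeg K (2 ^ m) * U m) ∧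
      ∀ j ∈ J, (⊤ : Submodule K (FA K)) * Submodule.span K {f j} * ⊤ ⊓ Adeg K (2 ^ (m + 2)) ≤
        Adeg K (2 ^ (m + 1)) * Fn ⊔ Fn * Adeg K (2 ^ (m + 1)) ⊔ blockIdeal U m := by
  have hpos : 1 ≤ J.card * 2 ^ (m + 1) * 2 ^ c :=
    Nat.one_le_iff_ne_zero.2 (by simp [hJ.ne_empty])
  have h2 : 2 ^ (m + 1) = 2 ^ m + 2 ^ m := by ring
  have h4 : 2 ^ (m + 2) = 2 ^ m + (2 ^ (m + 1) + 2 ^ m) := by ring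
  have hfin := Submodule.finiteDimensional_of_le (hVA m (by omega))
  have hVV : V m * V m ≤ Adeg K (2 ^ (m + 1)) := by
    rw [h2, ← Adeg_mul_Adeg]
    exact mul_le_mul' (hVA m (by omega)) (hVA m (by omega))
  have hP : ∀ x : ι × ℕ, ∃ P ≤ Adeg K (2 ^ (m + 1)), Module.finrank K P ≤ 2 ^ c ∧
      (x.1 ∈ J → ∀ i', x.2 + i' = d x.1 - 2 ^ (m + 1) →
        f x.1 ∈ Adeg K x.2 * P * Adeg K i' ⊔ Ult K U x.2 * Adeg K (d x.1 - x.2) ⊔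
          Adeg K (d x.1 - i') * Ugt K U i') := by
    rintro ⟨j, i⟩
    by_cases hij : j ∈ J ∧ i ≤ d j - 2 ^ (m + 1)
    · obtain ⟨hj, hi⟩ := hij
      obtain ⟨h1, h3⟩ := hd j hj
      have hfj := hf j
      obtain ⟨i', hi'⟩ := Nat.exists_eq_add_of_le hi
      rw [show d j = i + 2 ^ (m + 1) + i' by omega] at hfj
      obtain ⟨P, hPA, hP, hfP⟩ := exists_middle_space (U := U) hVA hVU hw (by omega) (by omega) hfj
      refine ⟨P, hPA, hP.trans (Nat.pow_le_pow_right two_pos (hc _ _ (by omega))), ?_⟩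
      intro _ k hk
      simp only at hk ⊢
      obtain rfl : k = i' := by omega
      rwa [show d j - i = 2 ^ (m + 1) + k by omega, show d j - k = i + 2 ^ (m + 1) by omega]
    · refine ⟨⊥, bot_le, by simp, fun hj i' hi' => absurd ⟨hj, ?_⟩ hij⟩
      simp only at hi'
      omega
  choose P hPA hPc hfP using hP
  have hT : ∀ x : ι × ℕ, ∃ T ≤ Adeg K (2 ^ (m + 2)), Module.finrank K T ≤ 2 ^ c ∧
      (x.1 ∈ J → ∀ i', x.2 + d x.1 + i' = 2 ^ (m + 2) →
        Adeg K x.2 * Submodule.span K {f x.1} * Adeg K i' ≤ T ⊔ blockIdeal U m) := by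
    rintro ⟨j, i⟩
    by_cases hij : j ∈ J ∧ i + d j ≤ 2 ^ (m + 2)
    · obtain ⟨hj, hi⟩ := hij
      obtain ⟨h1, h3⟩ := hd j hj
      obtain ⟨i', hi'⟩ := Nat.exists_eq_add_of_le hi
      obtain ⟨T, hTA, hT, hfT⟩ := hU.exists_multiples_space hVA hVU hw (N := m)
        (M := 2 ^ (m + 1) + 2 ^ m) (i := i) (j := i') (by omega) (by omega) (by omega) (by omega)
        (hf j)
      rw [← h4] at hTA
      refine ⟨T, hTA, hT.trans (Nat.pow_le_pow_right two_pos (hc _ _ (by omega))), ?_⟩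
      intro _ k hk
      simp only at hk ⊢
      obtain rfl : k = i' := by omega
      refine hfT.trans (sup_le_sup_left (sup_le ?_ le_sup_right) _)
      exact le_sup_of_le_left le_sup_right
    · refine ⟨⊥, bot_le, by simp, fun hj i' hi' => absurd ⟨hj, ?_⟩ hij⟩
      simp only at hi'
      omega
  choose T hTA hTc hfT using hT
  have hPf : ∀ x, FiniteDimensional K (P x) := fun x => Submodule.finiteDimensional_of_le (hPA x)
  have hTf : ∀ x, FiniteDimensional K (T x) := fun x => Submodule.finiteDimensional_of_le (hTA x)
  let s : Finset (ι × ℕ) := J ×ˢ Finset.range (2 ^ (m + 1))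
  have hs : s.card = J.card * 2 ^ (m + 1) := by simp [s]
  have hPs := Submodule.finrank_finset_sup_le s P (2 ^ c) hPc
  have hTs := Submodule.finrank_finset_sup_le s T (2 ^ c) hTc
  rw [hs] at hPs hTs
  obtain ⟨x, hxA, hx0⟩ := exists_nonzero_mem_Adeg (K := K) (2 ^ (m + 1))
  let F' : Submodule K (FA K) := Submodule.span K {x} ⊔ s.sup P
  have hF'A : F' ≤ Adeg K (2 ^ (m + 1)) :=
    sup_le (by simpa using hxA) (Finset.sup_le fun y _ => hPA y)
  have hF'f := Submodule.finiteDimensional_of_le hF'A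
  have hF'dim : Module.finrank K F' ≤ 1 + J.card * 2 ^ (m + 1) * 2 ^ c := by
    refine (Submodule.finrank_add_le_finrank_add_finrank _ _).trans (add_le_add ?_ hPs)
    simpa using finrank_span_le_card (R := K) ({x} : Set (FA K))
  obtain ⟨π, hπ⟩ := Submodule.exists_linearMap_range_eq_mul (V m) (V m)
  obtain ⟨F₀, hF₀dim, hF₀⟩ := Submodule.exists_finrank_le_map_sup π
    (U m * Adeg K (2 ^ m) ⊔ Adeg K (2 ^ m) * U m) F' (by
      rw [hπ]
      exact hF'A.trans (Adeg_two_pow_succ_le (hVA m (by omega)) (hVU m (by omega))))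
  let g := LinearMap.mul' K (FA K) ∘ₗ TensorProduct.map π π
  have hg : V m * V m * (V m * V m) ≤ LinearMap.range g := by
    rw [← hπ]
    refine Submodule.mul_le.2 ?_
    rintro _ ⟨a, rfl⟩ _ ⟨b, rfl⟩
    exact ⟨a ⊗ₜ b, by simp [g]⟩
  obtain ⟨T₀, hT₀dim, hT₀⟩ := Submodule.exists_finrank_le_map_sup g (blockIdeal U m) (s.sup T) (by
    refine (Finset.sup_le fun y _ => hTA y).trans ?_
    exact (Adeg_two_pow_add_two_le (hVA m (by omega)) (hVU m (by omega))).trans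
      (sup_le_sup_right hg _))
  have hW : Module.finrank K (Fin (Module.finrank K (V m) * Module.finrank K (V m)) → K) =
      Module.finrank K (V m) ^ 2 := by
    rw [Module.finrank_fin_fun, sq]
  obtain ⟨Z, hFZ, hZdim, hZ⟩ := exists_codim_two_forall_mem_mul_sup_mul π F₀ T₀ (by omega)
  have hZVV : Z.map π ≤ V m * V m := hπ ▸ LinearMap.map_le_range
  refine ⟨F', Z.map π, hF'A, hZVV.trans hVV, ?_, by omega, ?_, ?_, ?_, ?_⟩
  · intro h0
    have : x ∈ F' := Submodule.mem_sup_left (Submodule.mem_span_singleton_self x)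
    rw [h0] at this
    exact hx0 this
  · intro j hj i i' hi
    have hdj := hd j hj
    have hle : P (j, i) ≤ F' := le_sup_of_le_right
      (Finset.le_sup (f := P) (Finset.mem_product.2 ⟨hj, Finset.mem_range.2 (by
        change i < 2 ^ (m + 1)
        omega)⟩))
    have hmul : Adeg K i * P (j, i) * Adeg K i' ≤ Adeg K i * F' * Adeg K i' :=
      mul_le_mul' (mul_le_mul' le_rfl hle) le_rfl
    exact (sup_le_sup_right (sup_le_sup_right hmul _) _ :) (hfP (j, i) hj i' hi)
  · have := Submodule.finrank_map_le π Z
    omega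
  · exact hF₀.trans (sup_le_sup_right (Submodule.map_mono hFZ) _)
  · intro j hj
    have hdj := hd j hj
    refine ideal_inf_Adeg_le K (hf j) fun i i' hi => ?_
    have hle : T (j, i) ≤ s.sup T :=
      Finset.le_sup (f := T) (Finset.mem_product.2 ⟨hj, Finset.mem_range.2 (by
        change i < 2 ^ (m + 1)
        omega)⟩)
    refine (hfT (j, i) hj i' hi).trans (sup_le ((hle.trans hT₀).trans (sup_le_sup_right ?_ _))
      le_sup_right)
    rintro _ ⟨τ, hτ, rfl⟩
    have hmul := sup_le_sup (mul_le_mul' (hπ.trans_le hVV) (le_refl (Z.map π)))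
      (mul_le_mul' (le_refl (Z.map π)) (hπ.trans_le hVV))
    exact hmul (by rw [sup_comm]; exact hZ τ hτ)

end HomogeneousComponents

theorem bitWeight_add (w w' : ℕ → ℕ) (N i : ℕ) :
    bitWeight (w + w') N i = bitWeight w N i + bitWeight w' N i := by
  rw [bitWeight, bitWeight, bitWeight, ← Finset.sum_add_distrib]
  refine Finset.sum_congr rfl fun p _ => ?_
  split_ifs <;> simp

theorem bitWeight_le_sum (w : ℕ → ℕ) (N i : ℕ) : bitWeight w N i ≤ ∑ p ∈ Finset.range N, w p :=
  Finset.sum_le_sum fun p _ => by split_ifs <;> simp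

theorem bitWeight_two_pow (N i : ℕ) : bitWeight (2 ^ ·) N i = i % 2 ^ N := by
  induction N with
  | zero => simp [bitWeight, Nat.mod_one]
  | succ N ih =>
    rw [bitWeight, Finset.sum_range_succ, Nat.mod_pow_succ, ← ih, bitWeight,
      Nat.testBit_eq_decide_div_mod_eq]
    rcases Nat.mod_two_eq_zero_or_one (i / 2 ^ N) with h | h <;> simp [h]

theorem bitWeight_mul_le {w : ℕ → ℕ} {N b : ℕ} (h : ∀ p < N, w p * b ≤ 2 ^ p) (i : ℕ) :
    bitWeight w N i * b ≤ i := by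
  refine le_trans ?_ (Nat.mod_le i (2 ^ N))
  rw [← bitWeight_two_pow, bitWeight, bitWeight, Finset.sum_mul]
  refine Finset.sum_le_sum fun p hp => ?_
  split_ifs
  · exact h p (Finset.mem_range.1 hp)
  · simp

/-- The contribution of `k ∈ Y` to the exponents of the dimensions of the spaces `V(2^p)`. -/
def slotWeight (e : ℕ → ℕ) (k p : ℕ) : ℕ :=
  if p ∈ Set.Icc (k - e k - 1) (k - 1) then 2 ^ (p - (k - e k - 1)) else 0

theorem sum_slotWeight_le {e : ℕ → ℕ} {k : ℕ} (he : e k ≤ k - 1) (n : ℕ) :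
    ∑ p ∈ Finset.range n, slotWeight e k p ≤ 2 ^ (e k + 1) := by
  simp only [slotWeight]
  rw [← Finset.sum_filter]
  calc _ ≤ ∑ p ∈ Finset.Ico (k - e k - 1) (k - e k - 1 + (e k + 1)), 2 ^ (p - (k - e k - 1)) := by
        refine Finset.sum_le_sum_of_subset fun p hp => ?_
        have := (Finset.mem_filter.1 hp).2
        rw [Set.mem_Icc] at this
        rw [Finset.mem_Ico]
        omega
    _ = ∑ p ∈ Finset.range (e k + 1), 2 ^ p := by
        rw [Finset.sum_Ico_eq_sum_range]
        simp
    _ ≤ _ := (Nat.geomSum_lt le_rfl fun p hp => Finset.mem_range.1 hp).le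

/-- Exponents bounding the dimensions of the spaces `V(2^p)` with `p < n`. -/
def dimWeight (Y : Set ℕ) (e : ℕ → ℕ) (n : ℕ) : ℕ → ℕ :=
  slotWeight e n + fun p => 1 + ∑ k ∈ (Finset.range n).filter (· ∈ Y), slotWeight e k p

theorem bitWeight_dimWeight_add_le {Y : Set ℕ} {e : ℕ → ℕ} {n : ℕ}
    (he : ∀ k ∈ Y, 1 ≤ e k ∧ e k ≤ k - 1) (hn : n ∈ Y) {i j : ℕ}
    (hij : i + j ≤ 2 ^ (n - 1) + 2 ^ (n - 2)) :
    bitWeight (dimWeight Y e n) n i + bitWeight (dimWeight Y e n) n j ≤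
      2 ^ e n + 2 ^ (e n - 1) +
        (2 * n + ∑ k ∈ (Finset.range n).filter (· ∈ Y), 2 ^ (e k + 2)) := by
  obtain ⟨he1, he2⟩ := he n hn
  have hslot : ∀ p < n, slotWeight e n p * 2 ^ (n - e n - 1) ≤ 2 ^ p := by
    intro p _
    rw [slotWeight]
    split_ifs with hp
    · rw [← pow_add, Nat.sub_add_cancel hp.1]
    · simp
  have hi := bitWeight_mul_le hslot i
  have hj := bitWeight_mul_le hslot j
  have hsum : ∑ p ∈ Finset.range n, (1 + ∑ k ∈ (Finset.range n).filter (· ∈ Y), slotWeight e k p) ≤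
      n + ∑ k ∈ (Finset.range n).filter (· ∈ Y), 2 ^ (e k + 1) := by
    rw [Finset.sum_add_distrib, Finset.sum_comm]
    refine add_le_add (by simp) (Finset.sum_le_sum fun k hk => ?_)
    exact sum_slotWeight_le (he k (Finset.mem_filter.1 hk).2).2 n
  have h2 : ∑ k ∈ (Finset.range n).filter (· ∈ Y), 2 ^ (e k + 2) =
      2 * ∑ k ∈ (Finset.range n).filter (· ∈ Y), 2 ^ (e k + 1) := by
    rw [Finset.mul_sum]
    exact Finset.sum_congr rfl fun k _ => by ring
  have hmain : bitWeight (slotWeight e n) n i + bitWeight (slotWeight e n) n j ≤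
      2 ^ e n + 2 ^ (e n - 1) := by
    refine Nat.le_of_mul_le_mul_right (c := 2 ^ (n - e n - 1)) ?_ (by positivity)
    rw [add_mul, add_mul, ← pow_add, ← pow_add, show e n + (n - e n - 1) = n - 1 by omega,
      show e n - 1 + (n - e n - 1) = n - 2 by omega]
    omega
  rw [dimWeight, bitWeight_add, bitWeight_add]
  have hi' := bitWeight_le_sum
    (fun p => 1 + ∑ k ∈ (Finset.range n).filter (· ∈ Y), slotWeight e k p) n i
  have hj' := bitWeight_le_sum
    (fun p => 1 + ∑ k ∈ (Finset.range n).filter (· ∈ Y), slotWeight e k p) n j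
  omega

variable {K} in
theorem Conds.finrank_le {Y : Set ℕ} {e : ℕ → ℕ} {n : ℕ}
    (he : ∀ k ∈ Y, 1 ≤ e k ∧ e k ≤ k - 1)
    (hdisj : ∀ n ∈ Y, ∀ m ∈ Y, n ≠ m →
      Disjoint (Set.Icc (n - e n - 1) (n - 1)) (Set.Icc (m - e m - 1) (m - 1)))
    (hn : n ∈ Y) {F U V : ℕ → Submodule K (FA K)} {p : ℕ} (hp : p < n)
    (h : Conds K Y e F U V p) : Module.finrank K (V p) ≤ 2 ^ dimWeight Y e n p := by
  by_cases hpS : p ∈ SetS Y e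
  · simp only [SetS, Set.mem_iUnion] at hpS
    obtain ⟨k, hk, hpk⟩ := hpS
    have hek := he k hk
    have hkn : k ≤ n := by
      by_contra hlt
      have hen := he n hn
      rw [Set.mem_Icc] at hpk
      have hnk : n - 1 ∉ Set.Icc (n - e n - 1) (n - 1) :=
        Set.disjoint_left.1 (hdisj k hk n hn (by omega)) (Set.mem_Icc.2 (by omega))
      exact hnk (Set.mem_Icc.2 (by omega))
    have hdim := h.2.1 k hk (p - (k - e k - 1)) (by have := hpk.2; omega)
      (Nat.add_sub_cancel' hpk.1)
    have hslot : slotWeight e k p = 2 ^ (p - (k - e k - 1)) := if_pos hpk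
    rw [hdim]
    refine Nat.pow_le_pow_right two_pos ?_
    rw [← hslot, dimWeight, Pi.add_apply]
    rcases hkn.eq_or_lt with rfl | hlt
    · exact Nat.le_add_right _ _
    · have := Finset.single_le_sum (f := fun k => slotWeight e k p) (fun _ _ => Nat.zero_le _)
        (Finset.mem_filter.2 ⟨Finset.mem_range.2 hlt, hk⟩ : k ∈ (Finset.range n).filter (· ∈ Y))
      exact this.trans (by omega)
  · rw [h.1 hpS fun _ => ⟨n, hn, hp.le⟩]
    refine Nat.le_self_pow ?_ 2
    simp [dimWeight]

/-- **Proposition 6.3.**  Construction of the spaces `F'(2^n)` and `F(2^n)`. -/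
theorem statement19 [IsAlgClosed K]
    (ξ : ℕ) (f : Fin ξ → FA K) (d : Fin ξ → ℕ)
    (hpos : ∀ j, 1 ≤ d j) (hhom : ∀ j, f j ∈ Adeg K (d j))
    (r : ℕ → ℕ)
    (hr : ∀ i, r i = (Finset.univ.filter fun j => 2 ^ i < d j ∧ d j ≤ 2 ^ (i + 1)).card)
    (Y : Set ℕ) (hYdef : Y = {i : ℕ | r i ≠ 0})
    (hdeg : ∀ j, ∃ n : ℕ, 2 ≤ n ∧ 2 ^ n + 2 ^ (n - 1) ≤ d j ∧
      d j ≤ 2 ^ n + 2 ^ (n - 1) + 2 ^ (n - 2))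
    (e : ℕ → ℕ) (he : ∀ n ∈ Y, 1 ≤ e n ∧ e n ≤ n - 1)
    (hdisj : ∀ n ∈ Y, ∀ m ∈ Y, n ≠ m →
      Disjoint (Set.Icc (n - e n - 1) (n - 1)) (Set.Icc (m - e m - 1) (m - 1)))
    (hbound : ∀ n ∈ Y,
      r n * 2 ^ (3 * n + 4) *
        (∏ k ∈ Finset.range n, if k ∈ Y then 2 ^ 2 ^ (e k + 2) else 1) ≤
      2 ^ 2 ^ (e n - 1))
    (n : ℕ) (hn : n ∈ Y)
    (F U V : ℕ → Submodule K (FA K))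
    (hV0 : V 0 = Submodule.span K {FreeAlgebra.ι K 0, FreeAlgebra.ι K 1})
    (hU0 : U 0 = ⊥)
    (hconds : ∀ m, 1 ≤ m → m < n → Conds K Y e F U V m) :
    ∃ F' Fn : Submodule K (FA K), F' ≤ Adeg K (2 ^ n) ∧ Fn ≤ Adeg K (2 ^ n) ∧
      -- (i)
      F' ≠ ⊥ ∧ 2 * Module.rank K F' ≤ Module.rank K (V (n - 1)) ^ 2 ∧
      (∀ j : Fin ξ, 2 ^ n + 2 ^ (n - 1) ≤ d j → d j ≤ 2 ^ n + 2 ^ (n - 1) + 2 ^ (n - 2) →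
        ∀ i i' : ℕ, i + i' = d j - 2 ^ n →
          f j ∈ Adeg K i * F' * Adeg K i' ⊔ Ult K U i * Adeg K (d j - i) ⊔
            Adeg K (d j - i') * Ugt K U i') ∧
      -- (ii)  `dim F(2^n) ≤ (dim V(2^{n-1}))² − 2`
      Module.rank K Fn + 2 ≤ Module.rank K (V (n - 1)) ^ 2 ∧
      -- (iii)
      F' ≤ Fn ⊔ U (n - 1) * Adeg K (2 ^ (n - 1)) ⊔ Adeg K (2 ^ (n - 1)) * U (n - 1) ∧
      -- (iv)
      (∀ j : Fin ξ, 2 ^ n + 2 ^ (n - 1) ≤ d j → d j ≤ 2 ^ n + 2 ^ (n - 1) + 2 ^ (n - 2) →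
        (⊤ : Submodule K (FA K)) * Submodule.span K {f j} * ⊤ ⊓ Adeg K (2 ^ (n + 1)) ≤
          Adeg K (2 ^ n) * Fn ⊔ Fn * Adeg K (2 ^ n) ⊔
            Adeg K (2 ^ (n - 1)) * U (n - 1) * Adeg K (2 ^ n) ⊔
            Adeg K (2 ^ n) * U (n - 1) * Adeg K (2 ^ (n - 1)) ⊔
            U (n - 1) * Adeg K (2 ^ n + 2 ^ (n - 1)) ⊔
            Adeg K (2 ^ n + 2 ^ (n - 1)) * U (n - 1)) := by
  have hYr : ∀ i, i ∈ Y ↔ r i ≠ 0 := fun i => by rw [hYdef]; rfl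
  obtain ⟨he1, he2⟩ := he n hn
  obtain ⟨m, rfl⟩ : ∃ m, n = m + 1 := ⟨n - 1, by omega⟩
  simp only [Nat.add_sub_cancel, show m + 1 - 2 = m - 1 by omega] at he2 ⊢
  have hmm : 2 ^ m = 2 ^ (m - 1) + 2 ^ (m - 1) := by
    rw [← two_mul, ← pow_succ', Nat.sub_add_cancel (by omega)]
  have hm2 : 2 ^ (m + 1) = 2 ^ m + 2 ^ m := by ring
  have hcm : ∀ p, 1 ≤ p → p < m + 1 → Conds K Y e F U V p := hconds
  have hVU0 : V 0 = Adeg K 1 := by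
    rw [hV0, Adeg]
    congr 1
    ext x
    constructor
    · rintro (rfl | rfl)
      · exact ⟨[0], rfl, by simp⟩
      · exact ⟨[1], rfl, by simp⟩
    · rintro ⟨l, hl, rfl⟩
      obtain ⟨a, rfl⟩ := List.length_eq_one_iff.1 hl
      fin_cases a <;> simp
  have hVUA : ∀ p < m + 1, V p ⊔ U p = Adeg K (2 ^ p) := by
    rintro (_ | p) hp
    · simp [hU0, hVU0]
    · exact (hcm _ (by omega) hp).2.2.2.2.2.2.1
  have hVA : ∀ p < m + 1, V p ≤ Adeg K (2 ^ p) := fun p hp => hVUA p hp ▸ le_sup_left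
  have hVU : ∀ p < m + 1, Adeg K (2 ^ p) ≤ V p ⊔ U p := fun p hp => (hVUA p hp).ge
  have hU : UMulStable K U (m + 1) := fun p hp =>
    sup_le_iff.1 (hcm (p + 1) (by omega) hp).2.2.2.2.2.2.2.2.1
  have hw : ∀ p < m + 1, Module.finrank K (V p) ≤ 2 ^ dimWeight Y e (m + 1) p := by
    rintro (_ | p) hp
    · rw [hV0]
      refine (finrank_span_le_card (R := K) _).trans ?_
      refine le_trans ?_ (Nat.le_self_pow (by simp [dimWeight]) 2)
      rw [Set.toFinset_insert, Set.toFinset_singleton]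
      exact Finset.card_le_two
    · exact (hcm _ (by omega) hp).finrank_le he hdisj hn hp
  have hVm : Module.finrank K (V m) = 2 ^ 2 ^ e (m + 1) :=
    (hcm m (by omega) (by omega)).2.1 _ hn _ le_rfl (by omega)
  let J := Finset.univ.filter fun j =>
    2 ^ (m + 1) + 2 ^ m ≤ d j ∧ d j ≤ 2 ^ (m + 1) + 2 ^ m + 2 ^ (m - 1)
  have hJmem : ∀ j, j ∈ J ↔
      2 ^ (m + 1) + 2 ^ m ≤ d j ∧ d j ≤ 2 ^ (m + 1) + 2 ^ m + 2 ^ (m - 1) := by simp [J]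
  have hm1 : 1 ≤ 2 ^ (m - 1) := Nat.one_le_two_pow
  have hJr : J.card ≤ r (m + 1) := by
    rw [hr]
    refine Finset.card_le_card fun j hj => ?_
    have := (hJmem j).1 hj
    refine Finset.mem_filter.2 ⟨Finset.mem_univ _, by omega, ?_⟩
    rw [pow_succ 2 (m + 1)]
    omega
  have hJ : J.Nonempty := by
    have h0 := (hYr _).1 hn
    rw [hr] at h0
    obtain ⟨j, hj⟩ := Finset.card_ne_zero.1 h0
    obtain ⟨_, hj1, hj2⟩ := Finset.mem_filter.1 hj
    obtain ⟨k, hk, hk1, hk2⟩ := hdeg j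
    have hk3 : 2 ^ (k - 1) = 2 ^ (k - 2) + 2 ^ (k - 2) := by
      rw [← two_mul, ← pow_succ']
      congr 1
      omega
    have hk4 : 2 ^ k = 2 ^ (k - 1) + 2 ^ (k - 1) := by
      rw [← two_mul, ← pow_succ']
      congr 1
      omega
    have hk5 : 1 ≤ 2 ^ (k - 2) := Nat.one_le_two_pow
    have hlt1 : k < m + 1 + 1 := (Nat.pow_lt_pow_iff_right one_lt_two).1 (by omega)
    have hlt2 : m + 1 < k + 1 :=
      (Nat.pow_lt_pow_iff_right one_lt_two).1 (by rw [pow_succ 2 k]; omega)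
    obtain rfl : k = m + 1 := by omega
    exact ⟨j, (hJmem j).2 ⟨hk1, hk2⟩⟩
  have hdim : 16 * (J.card * 2 ^ (m + 1) * 2 ^ (2 ^ e (m + 1) + 2 ^ (e (m + 1) - 1) +
      (2 * (m + 1) + ∑ k ∈ (Finset.range (m + 1)).filter (· ∈ Y), 2 ^ (e k + 2)))) ≤
      Module.finrank K (V m) ^ 2 := by
    have hb := hbound _ hn
    rw [← Finset.prod_filter, Finset.prod_pow_eq_pow_sum] at hb
    have hee : 2 ^ e (m + 1) = 2 ^ (e (m + 1) - 1) + 2 ^ (e (m + 1) - 1) := by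
      rw [← two_mul, ← pow_succ', Nat.sub_add_cancel he1]
    rw [hVm, ← pow_mul, hee]
    generalize ∑ k ∈ (Finset.range (m + 1)).filter (· ∈ Y), 2 ^ (e k + 2) = σ at hb ⊢
    generalize 2 ^ (e (m + 1) - 1) = E at hb ⊢
    calc _ ≤ 16 * (r (m + 1) * 2 ^ (m + 1) * 2 ^ (E + E + E + (2 * (m + 1) + σ))) := by gcongr
      _ = r (m + 1) * 2 ^ (3 * (m + 1) + 4) * 2 ^ σ * 2 ^ (E + E + E) := by ring
      _ ≤ 2 ^ E * 2 ^ (E + E + E) := Nat.mul_le_mul_right _ hb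
      _ = _ := by ring
  obtain ⟨F', Fn, hF'A, hFnA, hF'0, hF', hfF', hFn, hF'Fn, hfFn⟩ :=
    hU.exists_relation_spaces (q := 2 ^ m + 2 ^ (m - 1)) hVA hVU hw J hJ f d hhom
      (fun j hj => by have := (hJmem j).1 hj; omega) (by omega)
      (fun i j hij => bitWeight_dimWeight_add_le he hn (by simpa using hij)) hdim
  have := Submodule.finiteDimensional_of_le hF'A
  have := Submodule.finiteDimensional_of_le hFnA
  have : FiniteDimensional K (V (m + 1 - 1)) :=
    Submodule.finiteDimensional_of_le (hVA m (by omega))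
  refine ⟨F', Fn, hF'A, hFnA, hF'0, ?_, fun j h1 h2 => hfF' j ((hJmem j).2 ⟨h1, h2⟩), ?_,
    by rwa [sup_assoc], fun j h1 h2 => ?_⟩
  · rw [← Module.finrank_eq_rank, ← Module.finrank_eq_rank]
    exact_mod_cast hF'
  · rw [← Module.finrank_eq_rank, ← Module.finrank_eq_rank]
    exact_mod_cast hFn
  · simpa only [blockIdeal, sup_assoc] using hfFn j ((hJmem j).2 ⟨h1, h2⟩)

end
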